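/- Let x ∈ J with det(x) = 0. Then ∇det(x) ≠ 0 if and only if x has rank r−1, where ∇det is the gradient of the polynomial function det with respect to the trace inner product ⟨x|y⟩ = tr(x·y). -/

import Mathlib

open scoped BigOperators Classical

/-- Bare data of a (real) Jordan algebra: a bilinear product and a unit element. -/
structure JordanData (J : Type) [AddCommGroup J] [Module ℝ J] where
  mul : J →ₗ[ℝ] J →ₗ[ℝ] J
  e : J

namespace JordanData

variable {J : Type} [AddCommGroup J] [Module ℝ J] (A : JordanData J)

/-- `c` is an idempotent. -/
def IsIdem (c : J) : Prop := A.mul c c = c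

/-- `c` is a primitive idempotent: a nonzero idempotent which dominates only `0` and itself. -/
def IsPrimitive (c : J) : Prop :=
  A.IsIdem c ∧ c ≠ 0 ∧ ∀ d : J, A.IsIdem d → A.mul c d = d → d = 0 ∨ d = c

/-- A Jordan frame: a complete system of pairwise orthogonal primitive idempotents. -/
def IsFrame {m : ℕ} (c : Fin m → J) : Prop :=
  (∀ j, A.IsPrimitive (c j)) ∧ (∀ i j, i ≠ j → A.mul (c i) (c j) = 0) ∧ ∑ j, c j = A.e

end JordanData

/-- A simple Euclidean Jordan algebra of rank `rank`, together with its trace `tr`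
and determinant `jdet` (characterized by their values on spectral decompositions). -/
structure EJA (J : Type) [NormedAddCommGroup J] [NormedSpace ℝ J] [FiniteDimensional ℝ J]
    extends JordanData J where
  comm : ∀ x y : J, mul x y = mul y x
  unit_mul : ∀ x : J, mul e x = x
  jordan : ∀ x y : J, mul (mul x x) (mul x y) = mul x (mul (mul x x) y)
  tr : J →ₗ[ℝ] ℝ
  tr_posdef : ∀ x : J, x ≠ 0 → 0 < tr (mul x x)
  simple : ∀ I : Submodule ℝ J, (∀ x ∈ I, ∀ y : J, mul y x ∈ I) → I = ⊥ ∨ I = ⊤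
  rank : ℕ
  spectral : ∀ x : J, ∃ (c : Fin rank → J) (lam : Fin rank → ℝ),
    toJordanData.IsFrame c ∧ x = ∑ j, lam j • c j
  tr_prim : ∀ c : J, toJordanData.IsPrimitive c → tr c = 1
  jdet : J → ℝ
  jdet_frame : ∀ (c : Fin rank → J) (lam : Fin rank → ℝ),
    toJordanData.IsFrame c → jdet (∑ j, lam j • c j) = ∏ j, lam j

namespace EJA

variable {J : Type} [NormedAddCommGroup J] [NormedSpace ℝ J] [FiniteDimensional ℝ J]

def IsIdem (A : EJA J) (c : J) : Prop := A.toJordanData.IsIdem c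

def IsPrimitive (A : EJA J) (c : J) : Prop := A.toJordanData.IsPrimitive c

def IsFrame (A : EJA J) {m : ℕ} (c : Fin m → J) : Prop := A.toJordanData.IsFrame c

/-- `x` has rank `k`: in a spectral decomposition of `x`, exactly `k` eigenvalues are nonzero. -/
def HasRank (A : EJA J) (x : J) (k : ℕ) : Prop :=
  ∃ (c : Fin A.rank → J) (lam : Fin A.rank → ℝ), A.IsFrame c ∧
    x = ∑ j, lam j • c j ∧ (Finset.univ.filter fun j => lam j ≠ 0).card = k

/-- The symmetric cone `Ω`: the interior of the set of squares. -/
def cone (A : EJA J) : Set J := interior {x : J | ∃ y : J, x = A.mul y y}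

/-- The Peirce space `J(c,t)`, i.e. the `t`-eigenspace of the multiplication operator `L(c)`. -/
def peirce (A : EJA J) (c : J) (t : ℝ) : Submodule ℝ J :=
  LinearMap.ker (A.mul c - t • (LinearMap.id : J →ₗ[ℝ] J))

/-- The symmetric cone of the Jordan subalgebra `J(c,t)` (`t = 1` or `t = 0`):
the relative interior, within `J(c,t)`, of the set of squares of elements of `J(c,t)`. -/
def subCone (A : EJA J) (c : J) (t : ℝ) : Set J :=
  {x : J | x ∈ A.peirce c t ∧ ∃ U : Set J, IsOpen U ∧ x ∈ U ∧
    ∀ y ∈ U, y ∈ A.peirce c t → ∃ w ∈ A.peirce c t, y = A.mul w w}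

/-- Powers in the Jordan algebra, with `x ^ 0 = e`. -/
def pow (A : EJA J) (x : J) : ℕ → J
  | 0 => A.e
  | n + 1 => A.mul x (A.pow x n)

/-- `y` is the Jordan inverse of `x`: `y` lies in the subalgebra `ℝ[x]` and `x·y = e`. -/
def IsInverse (A : EJA J) (x y : J) : Prop :=
  y ∈ Submodule.span ℝ (Set.range (A.pow x)) ∧ A.mul x y = A.e

/-- The set of invertible linear maps preserving the symmetric cone. -/
def conePreserving (A : EJA J) : Set (J →L[ℝ] J)ˣ :=
  {g | (g : J →L[ℝ] J) '' A.cone = A.cone}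

theorem one_mem_conePreserving (A : EJA J) : 1 ∈ A.conePreserving := by
  show (↑(1 : (J →L[ℝ] J)ˣ) : J →L[ℝ] J) '' A.cone = A.cone
  simp

/-- The group `L`: the identity component of the group of linear transformations of `J`
preserving the symmetric cone `Ω`. -/
def Lgroup (A : EJA J) : Set (J →L[ℝ] J)ˣ :=
  {g | ∃ h : g ∈ A.conePreserving,
    (⟨g, h⟩ : A.conePreserving) ∈ connectedComponent ⟨1, A.one_mem_conePreserving⟩}

end EJA

namespace EJA

variable {J : Type} [NormedAddCommGroup J] [NormedSpace ℝ J] [FiniteDimensional ℝ J]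

/-- Partially linearised Jordan identity. -/
theorem lin2 (A : EJA J) (x z y : J) :
    (2 : ℝ) • A.mul (A.mul x z) (A.mul x y) + A.mul (A.mul x x) (A.mul z y)
      = (2 : ℝ) • A.mul x (A.mul (A.mul x z) y) + A.mul z (A.mul (A.mul x x) y) := by
  have h1 := A.jordan (x + z) y
  have h2 := A.jordan (x - z) y
  have h4 := A.jordan z y
  simp only [map_add, map_sub, LinearMap.add_apply, LinearMap.sub_apply, A.comm z x] at h1 h2
  have h5 := congrArg₂ (fun a b => a - b) h1 h2
  have h6 := congrArg (fun a => (2 : ℝ)⁻¹ • a) h5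
  linear_combination (norm := module) h6 - h4

/-- Fully linearised Jordan identity. -/
theorem lin3 (A : EJA J) (x y z w : J) :
    A.mul (A.mul x y) (A.mul z w) + A.mul (A.mul y z) (A.mul x w)
        + A.mul (A.mul z x) (A.mul y w)
      = A.mul z (A.mul (A.mul x y) w) + A.mul x (A.mul (A.mul y z) w)
        + A.mul y (A.mul (A.mul z x) w) := by
  have h1 := A.lin2 (x + y) z w
  have h2 := A.lin2 x z w
  have h3 := A.lin2 y z w
  simp only [map_add, LinearMap.add_apply, A.comm y x, A.comm z x] at h1 h2 h3 ⊢
  have h5 := congrArg (fun a => (2 : ℝ)⁻¹ • a) h1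
  have h6 := congrArg (fun a => (2 : ℝ)⁻¹ • a) h2
  have h7 := congrArg (fun a => (2 : ℝ)⁻¹ • a) h3
  linear_combination (norm := module) h5 - h6 - h7

theorem peirce_poly (A : EJA J) (c : J) (hc : A.mul c c = c) (w : J) :
    (2 : ℝ) • A.mul c (A.mul c (A.mul c w)) = (3 : ℝ) • A.mul c (A.mul c w) - A.mul c w := by
  have h := A.lin3 c c w c
  simp only [hc, A.comm w c, A.comm (A.mul c w) c, A.comm w (A.mul c c)] at h
  linear_combination (norm := module) -h

theorem peirce_mul (A : EJA J) (c : J) (hc : A.mul c c = c) (α β : ℝ) (hα : 1 - 2 * α ≠ 0)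
    (a b : J) (ha : A.mul c a = α • a) (hb : A.mul c b = β • b) :
    A.mul c (A.mul a b) = β • A.mul a b := by
  have h := A.lin3 c c a b
  simp only [hc, A.comm a c, ha, hb, map_smul, LinearMap.smul_apply] at h
  have h2 : (1 - 2 * α) • A.mul c (A.mul a b) = (1 - 2 * α) • (β • A.mul a b) := by
    linear_combination (norm := module) h
  exact smul_right_injective J hα h2

theorem peirce_half (A : EJA J) (c : J) (hc : A.mul c c = c)
    (a b : J) (ha : A.mul c a = (1 / 2 : ℝ) • a) (hb : A.mul c b = (1 / 2 : ℝ) • b) :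
    A.mul c (A.mul c (A.mul a b)) = A.mul c (A.mul a b) := by
  have h := A.lin3 a b c c
  simp only [hc, A.comm a c, A.comm b c, A.comm (A.mul a b) c, ha, hb, map_smul,
    LinearMap.smul_apply, A.comm a c, A.comm b c, A.comm b a] at h
  linear_combination (norm := module) -h

theorem peirce_decomp (A : EJA J) (c : J) (hc : A.mul c c = c) (v : J) :
    ∃ a b d : J, v = a + b + d ∧ A.mul c a = (0 : ℝ) • a ∧ A.mul c b = (1 / 2 : ℝ) • b ∧
      A.mul c d = (1 : ℝ) • d := by
  have h := A.peirce_poly c hc v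
  refine ⟨v - (3 : ℝ) • A.mul c v + (2 : ℝ) • A.mul c (A.mul c v),
    (4 : ℝ) • A.mul c v - (4 : ℝ) • A.mul c (A.mul c v),
    (2 : ℝ) • A.mul c (A.mul c v) - A.mul c v, ?_, ?_, ?_, ?_⟩
  · module
  · simp only [map_add, map_sub, map_smul]
    linear_combination (norm := module) h
  · simp only [map_add, map_sub, map_smul]
    linear_combination (norm := module) (-2 : ℝ) • h
  · simp only [map_add, map_sub, map_smul]
    linear_combination (norm := module) h

/-- The Peirce reflection. -/
noncomputable def refl (A : EJA J) (c : J) : J →ₗ[ℝ] J :=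
  LinearMap.id - (8 : ℝ) • A.mul c + (8 : ℝ) • (A.mul c ∘ₗ A.mul c)

theorem refl_apply (A : EJA J) (c v : J) :
    A.refl c v = v - (8 : ℝ) • A.mul c v + (8 : ℝ) • A.mul c (A.mul c v) := by
  simp [refl]

theorem refl_zero (A : EJA J) (c v : J) (h : A.mul c v = (0 : ℝ) • v) : A.refl c v = v := by
  simp only [refl_apply, h, map_smul]; module

theorem refl_one (A : EJA J) (c v : J) (h : A.mul c v = (1 : ℝ) • v) : A.refl c v = v := by
  simp only [refl_apply, h, map_smul]; module

theorem refl_half (A : EJA J) (c v : J) (h : A.mul c v = (1 / 2 : ℝ) • v) :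
    A.refl c v = - v := by
  simp only [refl_apply, h, map_smul]; module

theorem refl_refl (A : EJA J) (c : J) (hc : A.mul c c = c) (v : J) :
    A.refl c (A.refl c v) = v := by
  obtain ⟨a, b, d, rfl, ha, hb, hd⟩ := A.peirce_decomp c hc v
  simp only [map_add, A.refl_zero c a ha, A.refl_half c b hb, A.refl_one c d hd, map_neg, neg_neg]

theorem refl_mul (A : EJA J) (c : J) (hc : A.mul c c = c) (v w : J) :
    A.refl c (A.mul v w) = A.mul (A.refl c v) (A.refl c w) := by
  obtain ⟨a, b, d, rfl, ha, hb, hd⟩ := A.peirce_decomp c hc v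
  obtain ⟨a', b', d', rfl, ha', hb', hd'⟩ := A.peirce_decomp c hc w
  have n0 : (1 - 2 * 0 : ℝ) ≠ 0 := by norm_num
  have n1 : (1 - 2 * 1 : ℝ) ≠ 0 := by norm_num
  have e1 := A.refl_zero c _ (A.peirce_mul c hc 0 0 n0 a a' ha ha')
  have e2 := A.refl_half c _ (A.peirce_mul c hc 0 _ n0 a b' ha hb')
  have e3 := A.refl_one c _ (A.peirce_mul c hc 0 _ n0 a d' ha hd')
  have e4 := A.refl_half c _ (A.peirce_mul c hc 0 _ n0 a' b ha' hb)
  have e5 : A.refl c (A.mul b b') = A.mul b b' := by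
    rw [refl_apply, A.peirce_half c hc b b' hb hb']; module
  have e6 := A.refl_half c _ (A.peirce_mul c hc 1 _ n1 d' b hd' hb)
  have e7 := A.refl_zero c _ (A.peirce_mul c hc 1 0 n1 d a' hd ha')
  have e8 := A.refl_half c _ (A.peirce_mul c hc 1 _ n1 d b' hd hb')
  have e9 := A.refl_one c _ (A.peirce_mul c hc 1 _ n1 d d' hd hd')
  rw [A.comm a' b] at e4
  rw [A.comm d' b] at e6
  simp only [map_add, LinearMap.add_apply, e1, e2, e3, e4, e5, e6, e7, e8, e9,
    A.refl_zero c a ha, A.refl_half c b hb, A.refl_one c d hd,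
    A.refl_zero c a' ha', A.refl_half c b' hb', A.refl_one c d' hd', map_neg, LinearMap.neg_apply]
  module

theorem jdet_refl (A : EJA J) (c : J) (hc : A.mul c c = c) (v : J) :
    A.jdet (A.refl c v) = A.jdet v := by
  obtain ⟨f, lam, ⟨hp, ho, hs⟩, rfl⟩ := A.spectral v
  have hm := A.refl_mul c hc
  have hr := A.refl_refl c hc
  have hfr : A.toJordanData.IsFrame (fun j => A.refl c (f j)) := by
    refine ⟨fun j => ⟨?_, ?_, ?_⟩, ?_, ?_⟩
    · have h1 : A.mul (f j) (f j) = f j := (hp j).1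
      show A.mul _ _ = _
      rw [← hm, h1]
    · intro h
      replace h : A.refl c (f j) = 0 := h
      apply (hp j).2.1
      rw [← hr (f j), h, map_zero]
    · intro d hd hd2
      have hd' : A.mul d d = d := hd
      have hd2' : A.mul (A.refl c (f j)) d = d := hd2
      have := (hp j).2.2 (A.refl c d) (by show A.mul _ _ = _; rw [← hm, hd'])
        (by show A.mul _ _ = _
            have h := hm (A.refl c (f j)) d
            rw [hr, hd2'] at h
            exact h.symm)
      rcases this with h | h
      · left; rw [← hr d, h, map_zero]
      · right; show d = A.refl c (f j); rw [← h, hr]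
    · intro i j hij
      have := ho i j hij
      show A.mul _ _ = _
      rw [← hm]
      rw [show A.mul (f i) (f j) = 0 from this, map_zero]
    · rw [← map_sum, hs, refl_apply, A.comm c, A.unit_mul, hc]
      module
  rw [A.jdet_frame f lam ⟨hp, ho, hs⟩, map_sum]
  simp only [map_smul]
  exact A.jdet_frame _ lam hfr

theorem mul_frame (A : EJA J) (f : Fin A.rank → J) (hf : A.toJordanData.IsFrame f)
    (a b : Fin A.rank → ℝ) :
    A.mul (∑ j, a j • f j) (∑ j, b j • f j) = ∑ j, (a j * b j) • f j := by
  simp only [map_sum, LinearMap.sum_apply, map_smul, LinearMap.smul_apply]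
  refine Finset.sum_congr rfl fun i _ => ?_
  rw [Finset.sum_eq_single i]
  · rw [show A.mul (f i) (f i) = f i from (hf.1 i).1, smul_smul, mul_comm]
  · intro j _ hj
    first
      | rw [show A.mul (f i) (f j) = 0 from hf.2.1 i j (Ne.symm hj)]
      | rw [show A.mul (f j) (f i) = 0 from hf.2.1 j i hj]
    simp
  · simp

theorem jdet_zero (A : EJA J) (c : J) (hc : A.mul c c = c) (hc0 : c ≠ 0) (y : J)
    (hy : A.mul c y = 0) : A.jdet y = 0 := by
  obtain ⟨f, μ, hf, rfl⟩ := A.spectral y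
  rw [A.jdet_frame f μ hf]
  by_contra hne
  have hμ : ∀ j, μ j ≠ 0 := fun j hj => hne (Finset.prod_eq_zero (Finset.mem_univ j) hj)
  have hpow : ∀ n : ℕ, A.mul c (∑ j, (μ j ^ (n + 1)) • f j) = 0 := by
    intro n
    induction n with
    | zero => simpa using hy
    | succ n ih =>
      have h := A.peirce_mul c hc 0 0 (by norm_num) _ _ (by rw [hy, zero_smul])
        (by rw [ih, zero_smul])
      rw [A.mul_frame f hf, zero_smul] at h
      simpa only [pow_succ' _ (n + 1)] using h
  have hpoly : ∀ p : Polynomial ℝ, A.mul c (∑ j, (p.eval (μ j) * μ j) • f j) = 0 := by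
    intro p
    induction p using Polynomial.induction_on' with
    | add p q hp hq =>
      simp only [Polynomial.eval_add, add_mul, add_smul, Finset.sum_add_distrib, map_add, hp, hq,
        add_zero]
    | monomial n a =>
      simp only [Polynomial.eval_monomial, mul_assoc, ← pow_succ]
      simp only [mul_smul, ← Finset.smul_sum, map_smul, hpow n, smul_zero]
  let p := Lagrange.interpolate (Finset.univ.image μ) id (fun t => t⁻¹)
  have hp : ∀ j, p.eval (μ j) = (μ j)⁻¹ := fun j =>
    Lagrange.eval_interpolate_at_node (v := id) (fun t : ℝ => t⁻¹) (Function.injective_id.injOn)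
      (Finset.mem_image_of_mem μ (Finset.mem_univ j))
  have h := hpoly p
  simp only [hp, inv_mul_cancel₀ (hμ _), one_smul] at h
  rw [hf.2.2, A.comm, A.unit_mul] at h
  exact hc0 h

theorem deriv_line (A : EJA J) (x v : J) (D : J →L[ℝ] ℝ) (hD : HasFDerivAt A.jdet D x) :
    HasDerivAt (fun t : ℝ => A.jdet (x + t • v)) (D v) 0 := by
  have h1 : HasDerivAt (fun t : ℝ => x + t • v) v 0 := by
    simpa using ((hasDerivAt_id (0 : ℝ)).smul_const v).const_add x
  have h2 : HasFDerivAt A.jdet D (x + (0 : ℝ) • v) := by simpa using hD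
  exact h2.comp_hasDerivAt (0 : ℝ) h1

theorem deriv_zero (A : EJA J) (x v : J) (D : J →L[ℝ] ℝ) (hD : HasFDerivAt A.jdet D x)
    (h : ∀ t : ℝ, A.jdet (x + t • v) = 0) : D v = 0 := by
  have h1 := A.deriv_line x v D hD
  simp only [h] at h1
  exact h1.unique (hasDerivAt_const _ _)

theorem deriv_half (A : EJA J) (x v : J) (D : J →L[ℝ] ℝ) (hD : HasFDerivAt A.jdet D x)
    (h : ∀ t : ℝ, A.jdet (x + t • v) = A.jdet (x + t • (-v))) : D v = 0 := by
  have h1 := A.deriv_line x v D hD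
  simp only [h] at h1
  have h2 := h1.unique (A.deriv_line x (-v) D hD)
  rw [map_neg] at h2
  linarith

end EJA

/-- Let `gdet : J → J` be the gradient of the determinant with respect
to the trace inner product `⟨x|y⟩ = tr(x·y)` (so that `D det(y)(v) = ⟨gdet y | v⟩` for
all `y, v`).  If `det x = 0`, then `∇det(x) ≠ 0` if and only if `x` has rank `r − 1`. -/
theorem EJA.grad_jdet_ne_zero_iff {J : Type} [NormedAddCommGroup J] [NormedSpace ℝ J]
    [FiniteDimensional ℝ J] (A : EJA J) (gdet : J → J)
    (hgdet : ∀ y : J, HasFDerivAt A.jdet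
      (LinearMap.toContinuousLinearMap (A.tr ∘ₗ A.mul (gdet y))) y)
    (x : J) (hx : A.jdet x = 0) :
    gdet x ≠ 0 ↔ A.HasRank x (A.rank - 1) := by
  constructor
  · intro hg
    obtain ⟨c, lam, hf, rfl⟩ := A.spectral x
    refine ⟨c, lam, hf, rfl, ?_⟩
    rw [A.jdet_frame c lam hf] at hx
    obtain ⟨i, -, hi⟩ := Finset.prod_eq_zero_iff.1 hx
    have huniq : ∀ j, lam j = 0 → j = i := by
      intro j hj
      by_contra hji
      apply hg
      by_contra hg0
      have hci : A.mul (c i) (c i) = c i := (hf.1 i).1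
      have hcj : A.mul (c j) (c j) = c j := (hf.1 j).1
      have hcij : A.mul (c i) (c j) = 0 := hf.2.1 i j (Ne.symm hji)
      have hk : ∀ k, lam k = 0 → A.mul (c k) (∑ l, lam l • c l) = 0 := by
        intro k hk
        rw [map_sum]
        refine Finset.sum_eq_zero fun l _ => ?_
        rw [map_smul]
        by_cases hlk : l = k
        · rw [hlk, hk, zero_smul]
        · rw [show A.mul (c k) (c l) = 0 from hf.2.1 k l (Ne.symm hlk), smul_zero]
      set x := ∑ l, lam l • c l
      have hD := hgdet x
      set D := LinearMap.toContinuousLinearMap (A.tr ∘ₗ A.mul (gdet x)) with hDdef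
      have hDv : ∀ v, D v = 0 := by
        intro v
        obtain ⟨a, b, d, rfl, ha, hb, hd⟩ := A.peirce_decomp (c i) hci v
        have h0 : D a = 0 := A.deriv_zero x a D hD fun t =>
          A.jdet_zero (c i) hci (hf.1 i).2.1 _ (by
            rw [map_add, map_smul, hk i hi, ha]; simp)
        have h1 : D b = 0 := A.deriv_half x b D hD fun t => by
          rw [← A.jdet_refl (c i) hci, map_add, map_smul, A.refl_half _ _ hb,
            A.refl_zero _ x (by rw [hk i hi, zero_smul])]
        have h2 : D d = 0 := A.deriv_zero x d D hD fun t =>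
          A.jdet_zero (c j) hcj (hf.1 j).2.1 _ (by
            have e1 := A.peirce_mul (c i) hci 1 0 (by norm_num) d (c j) hd
              (by rw [hcij, zero_smul])
            have e2 := A.peirce_mul (c i) hci 0 1 (by norm_num) (c j) d
              (by rw [hcij, zero_smul]) hd
            rw [A.comm d (c j), e2, one_smul, zero_smul] at e1
            rw [map_add, map_smul, hk j hj, e1]; simp)
        rw [map_add, map_add, h0, h1, h2]; simp
      have hpos := A.tr_posdef _ hg0
      have := hDv (gdet x)
      rw [hDdef] at this
      simp only [LinearMap.coe_toContinuousLinearMap', LinearMap.comp_apply] at this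
      linarith
    have : (Finset.univ.filter fun j => lam j ≠ 0) = Finset.univ.erase i := by
      ext j
      simp only [Finset.mem_filter, Finset.mem_univ, true_and, Finset.mem_erase, and_true]
      constructor
      · rintro h rfl; exact h hi
      · intro h hj; exact h (huniq j hj)
    rw [this, Finset.card_erase_of_mem (Finset.mem_univ i)]
    simp
  · rintro ⟨c, lam, hf, rfl, hcard⟩ hg
    have hf' : A.toJordanData.IsFrame c := hf
    rw [A.jdet_frame c lam hf'] at hx
    obtain ⟨i, -, hi⟩ := Finset.prod_eq_zero_iff.1 hx
    have hsub : (Finset.univ.filter fun j => lam j ≠ 0) = Finset.univ.erase i := by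
      apply Finset.eq_of_subset_of_card_le
      · intro j hj
        rw [Finset.mem_filter] at hj
        rw [Finset.mem_erase]
        exact ⟨fun h => hj.2 (h ▸ hi), Finset.mem_univ j⟩
      · rw [hcard, Finset.card_erase_of_mem (Finset.mem_univ i)]
        simp
    have h1 := A.deriv_line _ (c i) _ (hgdet (∑ j, lam j • c j))
    have h2 : ∀ t : ℝ, A.jdet (∑ j, lam j • c j + t • c i)
        = t * ∏ j ∈ Finset.univ.erase i, lam j := by
      intro t
      have : ∑ j, lam j • c j + t • c i = ∑ j, (Function.update lam i t j) • c j := by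
        rw [← Finset.add_sum_erase _ _ (Finset.mem_univ i),
          ← Finset.add_sum_erase _ (fun j => Function.update lam i t j • c j) (Finset.mem_univ i)]
        rw [hi, zero_smul, zero_add, Function.update_self, add_comm]
        congr 1
        refine Finset.sum_congr rfl fun j hj => ?_
        rw [Function.update_of_ne (Finset.ne_of_mem_erase hj)]
      rw [this, A.jdet_frame c _ hf', ← Finset.mul_prod_erase _ _ (Finset.mem_univ i),
        Function.update_self]
      congr 1
      refine Finset.prod_congr rfl fun j hj => ?_
      rw [Function.update_of_ne (Finset.ne_of_mem_erase hj)]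
    simp only [h2] at h1
    have h3 := h1.unique ((hasDerivAt_id (0 : ℝ)).mul_const (∏ j ∈ Finset.univ.erase i, lam j))
    rw [hg] at h3
    simp only [LinearMap.coe_toContinuousLinearMap', LinearMap.comp_apply, map_zero,
      LinearMap.zero_apply, one_mul] at h3
    refine Finset.prod_ne_zero_iff.2 (fun j hj => ?_) h3.symm
    rw [← hsub, Finset.mem_filter] at hj
    exact hj.2
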